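/- Let n be a Lie algebra over k that is nilpotent of class at most 2 (i.e. {{x,y},z} = 0 for all x,y,z). Let n ⋊ Der(n) be the semidirect product with bracket [(x,D),(x',D')] = ({x,x'} + D(x') − D'(x), [D,D']), and let V ⋊ gl(V) be the semidirect product of the abelian Lie algebra on the underlying vector space V with gl(V), with bracket [(x,A),(x',A')] = (A(x') − A'(x), [A,A']). Then the map ψ: n ⋊ Der(n) → V ⋊ gl(V), (x,D) ↦ (x, (1/2)·ad(x) + D), where ad(x) = {x,·}, is an injective homomorphism of Lie algebras. -/

import Mathlib

/-- The bracket of the semidirect product `n ⋊ Der(n)`: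
`[(x,D),(x',D')] = ({x,x'} + D(x') - D'(x), [D,D'])`. -/
def sdBracket (k : Type*) {n : Type*} [Field k] [LieRing n] [LieAlgebra k n]
    (a b : n × LieDerivation k n n) : n × LieDerivation k n n :=
  (⁅a.1, b.1⁆ + a.2 b.1 - b.2 a.1, ⁅a.2, b.2⁆)

/-- The map `ψ : n ⋊ Der(n) → V ⋊ gl(V)`, `(x, D) ↦ (x, (1/2)·ad(x) + D)`. -/
def psiHalfAd (k : Type*) {n : Type*} [Field k] [LieRing n] [LieAlgebra k n]
    (a : n × LieDerivation k n n) : n × Module.End k n :=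
  (a.1, ((2 : k)⁻¹ • LieAlgebra.ad k n a.1) + a.2.toLinearMap)

/-- Lemma 4.1: if `n` is nilpotent of class at most 2, then
`ψ : n ⋊ Der(n) → V ⋊ gl(V)`, `(x,D) ↦ (x, (1/2)·ad(x) + D)` is an injective
homomorphism of Lie algebras, where `V ⋊ gl(V)` carries the bracket
`[(x,A),(x',A')] = (A(x') - A'(x), A∘A' - A'∘A)`. -/
theorem psiHalfAd_injective_hom (k n : Type*) [Field k] [CharZero k]
    [LieRing n] [LieAlgebra k n] [FiniteDimensional k n]
    (h2 : ∀ x y z : n, ⁅⁅x, y⁆, z⁆ = 0) :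
    IsLinearMap k (psiHalfAd k (n := n)) ∧
    Function.Injective (psiHalfAd k (n := n)) ∧
    (∀ a b : n × LieDerivation k n n,
      psiHalfAd k (sdBracket k a b) =
        ((psiHalfAd k a).2 (psiHalfAd k b).1 - (psiHalfAd k b).2 (psiHalfAd k a).1,
         (psiHalfAd k a).2 * (psiHalfAd k b).2 - (psiHalfAd k b).2 * (psiHalfAd k a).2)) := by
  have h2' : ∀ x y z : n, ⁅x, ⁅y, z⁆⁆ = 0 := fun x y z ↦ by
    rw [← lie_skew, h2, neg_zero]
  refine ⟨⟨fun a b ↦ ?_, fun c a ↦ ?_⟩, fun a b hab ↦ ?_, fun a b ↦ ?_⟩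
  · refine Prod.ext rfl (LinearMap.ext fun z ↦ ?_)
    simp [psiHalfAd]
    abel
  · refine Prod.ext rfl (LinearMap.ext fun z ↦ ?_)
    simp [psiHalfAd, smul_comm c]
  · have hfst : a.1 = b.1 := (Prod.ext_iff.mp hab).1
    refine Prod.ext hfst (LieDerivation.ext fun z ↦ ?_)
    have hsnd := LinearMap.congr_fun (Prod.ext_iff.mp hab).2 z
    simpa [psiHalfAd, hfst] using hsnd
  · obtain ⟨x, D⟩ := a
    obtain ⟨y, E⟩ := b
    refine Prod.ext ?_ (LinearMap.ext fun z ↦ ?_)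
    · have hskew : ⁅y, x⁆ = -⁅x, y⁆ := (lie_skew y x).symm
      simp only [psiHalfAd, sdBracket, LinearMap.add_apply, LinearMap.smul_apply,
        LieAlgebra.ad_apply, LieDerivation.coeFn_coe, hskew]
      module
    · have hD : ⁅z, D y⁆ = -⁅D y, z⁆ := (lie_skew z (D y)).symm
      have hE : ⁅z, E x⁆ = -⁅E x, z⁆ := (lie_skew z (E x)).symm
      simp only [psiHalfAd, sdBracket, LinearMap.add_apply, LinearMap.sub_apply,
        LinearMap.smul_apply, Module.End.mul_apply, LieAlgebra.ad_apply, map_add, map_smul,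
        LieDerivation.coeFn_coe, LieDerivation.lie_apply, LieDerivation.apply_lie_eq_sub,
        add_lie, sub_lie, h2, h2', hD, hE]
      module
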